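/- Let p and q be distinct primes and let G be a finite group of order p^n q^m whose Sylow p-subgroups have center of order p and whose Sylow q-subgroups have center of order q. If the center of G is trivial and |CD(G)| = |L(G)| - 2, then the two subgroups of G outside CD(G) are the trivial subgroup and a Sylow subgroup, and G is a non-abelian group of order pq (i.e., n = m = 1). -/

import Mathlib

/-- The Chermak-Delgado measure of a subgroup `H` of `G`: `m_G(H) = |H| * |C_G(H)|`. -/
noncomputable def cdMeasure (G : Type*) [Group G] (H : Subgroup G) : ℕ :=
  Nat.card H * Nat.card (Subgroup.centralizer (H : Set G))

/-- The Chermak-Delgado lattice of `G`: the set of subgroups whose Chermak-Delgado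
measure is maximal among all subgroups of `G`. -/
def cdLattice (G : Type*) [Group G] : Set (Subgroup G) :=
  {H | ∀ K : Subgroup G, cdMeasure G K ≤ cdMeasure G H}

namespace Subgroup

variable {G : Type*} [Group G] [Finite G]

theorem card_mul_card_le_card_sup_mul_card_inf (H K : Subgroup G) :
    Nat.card H * Nat.card K ≤ Nat.card (H ⊔ K : Subgroup G) * Nat.card (H ⊓ K : Subgroup G) := by
  have hsup : Nat.card K * K.relIndex (H ⊔ K) = Nat.card (H ⊔ K : Subgroup G) := by
    simpa [relIndex_bot_left] using relIndex_mul_relIndex ⊥ K (H ⊔ K) bot_le le_sup_right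
  have hinf : Nat.card (H ⊓ K : Subgroup G) * K.relIndex H = Nat.card H := by
    simpa [relIndex_bot_left, inf_relIndex_left] using
      relIndex_mul_relIndex ⊥ (H ⊓ K) H bot_le inf_le_left
  have hle : K.relIndex H ≤ K.relIndex (H ⊔ K) :=
    relIndex_le_of_le_right le_sup_left FiniteIndex.index_ne_zero
  rw [← hsup, ← hinf]
  calc _ = Nat.card K * K.relIndex H * Nat.card (H ⊓ K : Subgroup G) := by ring
    _ ≤ _ := by gcongr

theorem card_centralizer_mul_card_centralizer_le (H K : Subgroup G) :
    Nat.card (centralizer (H : Set G)) * Nat.card (centralizer (K : Set G)) ≤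
      Nat.card (centralizer ((H ⊔ K : Subgroup G) : Set G)) *
        Nat.card (centralizer ((H ⊓ K : Subgroup G) : Set G)) := by
  have hinf : centralizer (H : Set G) ⊓ centralizer (K : Set G) ≤
      centralizer ((H ⊔ K : Subgroup G) : Set G) := by
    rw [le_centralizer_iff]
    exact sup_le (le_centralizer_iff.mp inf_le_left) (le_centralizer_iff.mp inf_le_right)
  have hsup : centralizer (H : Set G) ⊔ centralizer (K : Set G) ≤
      centralizer ((H ⊓ K : Subgroup G) : Set G) :=
    sup_le (centralizer_le inf_le_left) (centralizer_le inf_le_right)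
  grw [card_mul_card_le_card_sup_mul_card_inf, mul_comm, card_le_of_le hinf, card_le_of_le hsup]

end Subgroup

section ChermakDelgado

variable {G : Type*} [Group G] [Finite G]

theorem card_sup_mul_card_inf_of_mem_cdLattice {H K : Subgroup G}
    (hH : H ∈ cdLattice G) (hK : K ∈ cdLattice G) :
    Nat.card (H ⊔ K : Subgroup G) * Nat.card (H ⊓ K : Subgroup G) =
      Nat.card H * Nat.card K := by
  refine le_antisymm ?_ (Subgroup.card_mul_card_le_card_sup_mul_card_inf H K)
  have hle := Nat.mul_le_mul (hH (H ⊔ K)) (hK (H ⊓ K))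
  have hc := Subgroup.card_centralizer_mul_card_centralizer_le H K
  have hpos : 0 < Nat.card (Subgroup.centralizer (H : Set G)) *
      Nat.card (Subgroup.centralizer (K : Set G)) := Nat.mul_pos Nat.card_pos Nat.card_pos
  refine Nat.le_of_mul_le_mul_right ?_ hpos
  unfold cdMeasure at hle
  grw [hc]
  linarith

open scoped Pointwise in
theorem conj_smul_mem_cdLattice {H : Subgroup G} (hH : H ∈ cdLattice G) (g : G) :
    MulAut.conj g • H ∈ cdLattice G := by
  intro K
  refine (hH K).trans ?_
  have hle := Subgroup.map_centralizer_le_centralizer_image (H : Set G)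
    (MulAut.conj g).toMonoidHom
  have hcard := Subgroup.card_le_of_le hle
  rw [Subgroup.card_map_of_injective (MulAut.conj g).injective] at hcard
  have hHcard : Nat.card (MulAut.conj g • H : Subgroup G) = Nat.card H :=
    Subgroup.card_map_of_injective (MulAut.conj g).injective
  rw [cdMeasure, cdMeasure, hHcard]
  exact Nat.mul_le_mul_left _ hcard

theorem Sylow.eq_of_mem_cdLattice {p : ℕ} [Fact p.Prime] {P Q : Sylow p G}
    (hP : (P : Subgroup G) ∈ cdLattice G) (hQ : (Q : Subgroup G) ∈ cdLattice G) : P = Q := by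
  obtain ⟨a, ha⟩ := IsPGroup.iff_card.mp P.isPGroup'
  obtain ⟨b, hb⟩ := IsPGroup.iff_card.mp Q.isPGroup'
  have hcard := card_sup_mul_card_inf_of_mem_cdLattice hP hQ
  rw [ha, hb, ← pow_add] at hcard
  obtain ⟨c, -, hc⟩ := (Nat.dvd_prime_pow Fact.out).mp (Dvd.intro _ hcard)
  have hsup := IsPGroup.of_card hc
  exact Sylow.ext ((P.is_maximal' hsup le_sup_left).symm.trans
    (Q.is_maximal' hsup le_sup_right))

theorem Sylow.normal_of_card_compl_cdLattice_le_two
    (h : Nat.card ((cdLattice G)ᶜ : Set (Subgroup G)) ≤ 2)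
    {p : ℕ} [hp : Fact p.Prime] (P : Sylow p G) : (P : Subgroup G).Normal := by
  suffices Subsingleton (Sylow p G) from Sylow.normal_of_subsingleton P
  by_cases hmem : (P : Subgroup G) ∈ cdLattice G
  · have hall (Q : Sylow p G) : (Q : Subgroup G) ∈ cdLattice G := by
      obtain ⟨g, rfl⟩ := MulAction.exists_smul_eq G P Q
      exact conj_smul_mem_cdLattice hmem g
    exact ⟨fun Q R => Sylow.eq_of_mem_cdLattice (hall Q) (hall R)⟩
  · have hall (Q : Sylow p G) : (Q : Subgroup G) ∈ (cdLattice G)ᶜ := by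
      intro hQ
      obtain ⟨g, rfl⟩ := MulAction.exists_smul_eq G Q P
      exact hmem (conj_smul_mem_cdLattice hQ g)
    have hcard : Nat.card (Sylow p G) ≤ 2 :=
      (Nat.card_le_card_of_injective (fun Q : Sylow p G => (⟨Q, hall Q⟩ : ↥(cdLattice G)ᶜ))
        fun Q R hQR => Sylow.ext (congrArg Subtype.val hQR)).trans h
    have hdvd : p ∣ Nat.card (Sylow p G) - 1 :=
      (Nat.modEq_iff_dvd' Nat.card_pos).mp (card_sylow_modEq_one p G).symm
    have h2 := hp.out.two_le
    have hzero := Nat.eq_zero_of_dvd_of_lt hdvd (by omega)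
    exact Finite.card_le_one_iff_subsingleton.mp (by omega)

theorem Group.isNilpotent_of_card_compl_cdLattice_le_two
    (h : Nat.card ((cdLattice G)ᶜ : Set (Subgroup G)) ≤ 2) : Group.IsNilpotent G :=
  (Group.isNilpotent_of_finite_tfae (G := G).out 3 0 rfl rfl).mp fun _ _ P =>
    Sylow.normal_of_card_compl_cdLattice_le_two h P

end ChermakDelgado

/-- Let `G` be a finite group of order `p^n q^m` (`p ≠ q` primes) whose Sylow
`p`-subgroups have center of order `p` and whose Sylow `q`-subgroups have center of
order `q`. If the center of `G` is trivial and `|CD(G)| = |L(G)| - 2`, then the two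
subgroups outside `CD(G)` are the trivial subgroup and a Sylow subgroup, `G` is
non-abelian, and `n = m = 1`. -/
theorem cd_eq_sub_two_trivial_center (G : Type*) [Group G] [Finite G] (p q n m : ℕ)
    (hp : p.Prime) (hq : q.Prime) (hpq : p ≠ q) (hG : Nat.card G = p ^ n * q ^ m)
    (hP : ∀ P : Sylow p G, Nat.card (Subgroup.center (P : Subgroup G)) = p)
    (hQ : ∀ Q : Sylow q G, Nat.card (Subgroup.center (Q : Subgroup G)) = q)
    (hZ : Subgroup.center G = ⊥)
    (h : Nat.card (cdLattice G) = Nat.card (Subgroup G) - 2) :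
    (∃ r : ℕ, (r = p ∨ r = q) ∧ ∃ S : Sylow r G,
        cdLattice G = Set.univ \ {(⊥ : Subgroup G), (S : Subgroup G)}) ∧
      (¬ ∀ a b : G, a * b = b * a) ∧ n = 1 ∧ m = 1 := by
  exfalso
  have hcompl : Nat.card ((cdLattice G)ᶜ : Set (Subgroup G)) ≤ 2 := by
    have hadd := Set.ncard_add_ncard_compl (cdLattice G)
    simp only [← Nat.card_coe_set_eq] at hadd
    omega
  have := Group.isNilpotent_of_card_compl_cdLattice_le_two hcompl
  have : Nontrivial G := by
    by_contra hG'
    rw [not_nontrivial_iff_subsingleton] at hG'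
    exact hp.one_lt.ne ((hP default).symm.trans Nat.card_unique).symm
  exact Group.IsNilpotent.center_ne_bot G hZ
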